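/- arXiv:1808.05011 — 2 statements merged into one kernel-verified Lean document; each statement's English description precedes it below -/
import Mathlib

section
/- Let S be a commutative ℝ-algebra, let k, l ∈ ℕ, let a ∈ ℝ^k, and let n₁, …, n_k ∈ S satisfy n_i^{l+1} = 0 for every i. For each infinitely differentiable function h : ℝ^k → ℝ define T(h) := Σ_{d = (d₁,…,d_k), 0 ≤ d_i ≤ l} (d₁!⋯d_k!)⁻¹ · ((∂₁^{d₁}⋯∂_k^{d_k} h)(a)) · n₁^{d₁}⋯n_k^{d_k} ∈ S. Then T is an ℝ-algebra homomorphism from C^∞(ℝ^k;ℝ) to S: T is ℝ-linear, T(1) = 1, and T(h₁·h₂) = T(h₁)·T(h₂) for all smooth h₁, h₂ : ℝ^k → ℝ. -/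
noncomputable section

namespace NilTaylor

/-- The partial derivative `∂_i h` of a real function on `ℝ^k`. -/
def pderiv1 {k : ℕ} (i : Fin k) (h : (Fin k → ℝ) → ℝ) : (Fin k → ℝ) → ℝ := fun x =>
  fderiv ℝ h x (Pi.single i 1)

/-- Iterated partial derivative `∂_i^n h`. -/
def pderivIter {k : ℕ} (i : Fin k) : ℕ → ((Fin k → ℝ) → ℝ) → (Fin k → ℝ) → ℝ
  | 0 => fun h => h
  | m + 1 => fun h => pderiv1 i (pderivIter i m h)

/-- The iterated partial derivative `∂₁^{d₁}⋯∂_k^{d_k} h` for a multi-index `d`. -/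
def multiPDeriv {k : ℕ} (d : Fin k → ℕ) (h : (Fin k → ℝ) → ℝ) : (Fin k → ℝ) → ℝ :=
  (List.finRange k).foldr (fun i acc => pderivIter i (d i) acc) h

/-- The nilpotent Taylor evaluation
`T(h) := Σ_{d, 0 ≤ d_i ≤ l} (d₁!⋯d_k!)⁻¹ ((∂₁^{d₁}⋯∂_k^{d_k} h)(a)) · n₁^{d₁}⋯n_k^{d_k}`,
i.e. the evaluation `h(a₁·1 + n₁, …, a_k·1 + n_k)` at a real point perturbed by
commuting nilpotent elements. -/
def nilTaylor (S : Type*) [CommRing S] [Algebra ℝ S] (k l : ℕ) (a : Fin k → ℝ)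
    (n : Fin k → S) (h : (Fin k → ℝ) → ℝ) : S :=
  ∑ d : Fin k → Fin (l + 1),
    ((((∏ i, ((d i : ℕ)).factorial) : ℕ) : ℝ)⁻¹ *
        multiPDeriv (fun i => (d i : ℕ)) h a) •
      ∏ i, n i ^ (d i : ℕ)

theorem iter_leibniz {A : Type*} [CommRing A] [Algebra ℝ A] (D : Derivation ℝ A A) (f g : A)
    (m : ℕ) : D^[m] (f * g) =
      ∑ ij ∈ Finset.HasAntidiagonal.antidiagonal m, m.choose ij.1 • (D^[ij.1] f * D^[ij.2] g) := by
  induction m with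
  | zero => simp
  | succ m ih =>
    rw [Function.iterate_succ_apply', ih, map_sum,
      Finset.sum_antidiagonal_choose_succ_nsmul (M := A) (fun i j => D^[i] f * D^[j] g) m,
      ← Finset.sum_add_distrib]
    refine Finset.sum_congr rfl fun ij hij => ?_
    have h1 : m.choose ij.2 = m.choose ij.1 :=
      (m.choose_symm_of_eq_add (Finset.HasAntidiagonal.mem_antidiagonal.1 hij).symm).symm
    rw [h1, ← smul_add, map_nsmul, Derivation.leibniz]
    simp only [Function.iterate_succ_apply', smul_eq_mul]
    congr 1
    ring

theorem trunc_mul {S : Type*} [CommRing S] (N : ℕ) (F : ℕ → ℕ → S)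
    (hF : ∀ p q, N ≤ p + q → F p q = 0) :
    ∑ m ∈ Finset.range N, ∑ ij ∈ Finset.HasAntidiagonal.antidiagonal m, F ij.1 ij.2 =
      ∑ p ∈ Finset.range N, ∑ q ∈ Finset.range N, F p q := by
  rw [← Finset.sum_product', Finset.sum_sigma']
  rw [← Finset.sum_filter_add_sum_filter_not (Finset.range N ×ˢ Finset.range N)
    (fun x => x.1 + x.2 < N)]
  rw [Finset.sum_eq_zero (s := Finset.filter (fun x : ℕ × ℕ => ¬ (x.1 + x.2 < N)) _)]
  · rw [add_zero]
    refine Finset.sum_bij' (fun x _ => x.2) (fun x _ => ⟨x.1 + x.2, x⟩) ?_ ?_ ?_ ?_ ?_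
    · rintro ⟨m, p, q⟩ h
      simp at h ⊢
      omega
    · rintro ⟨p, q⟩ h
      simp at h ⊢
      omega
    · rintro ⟨m, p, q⟩ h
      simp at h ⊢
      omega
    · rintro ⟨p, q⟩ h
      simp
    · rintro ⟨m, p, q⟩ h
      simp
  · rintro ⟨p, q⟩ h
    simp at h
    exact hF _ _ h.2

/-- One-variable step. -/
theorem step {A S : Type*} [CommRing A] [Algebra ℝ A] [CommRing S] [Algebra ℝ S]
    (D : Derivation ℝ A A) (l : ℕ) (s : S) (hs : s ^ (l + 1) = 0) (φ : A →ₐ[ℝ] S) :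
    ∃ ψ : A →ₐ[ℝ] S, ∀ f, ψ f =
      ∑ m : Fin (l + 1), (((m : ℕ).factorial : ℝ)⁻¹ • φ (D^[m] f)) * s ^ (m : ℕ) := by
  have hD : ∀ m f, D^[m] f = ((D : A →ₗ[ℝ] A) ^ m) f := by
    intro m f
    rw [Module.End.pow_apply]
    rfl
  let L : A →ₗ[ℝ] S :=
    { toFun := fun f => ∑ m ∈ Finset.range (l + 1),
        ((m.factorial : ℝ)⁻¹ • φ (D^[m] f)) * s ^ m
      map_add' := by
        intro f g
        simp only [hD, map_add, smul_add, add_mul, Finset.sum_add_distrib]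
      map_smul' := by
        intro c f
        simp only [hD, map_smul, Finset.smul_sum, RingHom.id_apply]
        refine Finset.sum_congr rfl fun m _ => ?_
        rw [smul_comm, smul_mul_assoc] }
  refine ⟨AlgHom.ofLinearMap L ?_ ?_, fun f => ?_⟩
  · change ∑ m ∈ Finset.range (l + 1), ((m.factorial : ℝ)⁻¹ • φ (D^[m] 1)) * s ^ m = 1
    rw [Finset.sum_eq_single 0]
    · simp
    · intro m _ hm
      obtain ⟨m, rfl⟩ := Nat.exists_eq_succ_of_ne_zero hm
      rw [Function.iterate_succ_apply, Derivation.map_one_eq_zero, hD]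
      simp
    · simp
  · intro f g
    change ∑ m ∈ Finset.range (l + 1), ((m.factorial : ℝ)⁻¹ • φ (D^[m] (f * g))) * s ^ m =
      (∑ m ∈ Finset.range (l + 1), ((m.factorial : ℝ)⁻¹ • φ (D^[m] f)) * s ^ m) *
      (∑ m ∈ Finset.range (l + 1), ((m.factorial : ℝ)⁻¹ • φ (D^[m] g)) * s ^ m)
    rw [Finset.sum_mul_sum, ← trunc_mul]
    · refine Finset.sum_congr rfl fun m _ => ?_
      rw [iter_leibniz, map_sum, Finset.smul_sum, Finset.sum_mul]
      refine Finset.sum_congr rfl fun ij hij => ?_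
      have h := Finset.HasAntidiagonal.mem_antidiagonal.1 hij
      subst h
      have hc : ((ij.1 + ij.2).choose ij.1 : ℝ) * ij.1.factorial * ij.2.factorial
          = (ij.1 + ij.2).factorial := by
        rw [Nat.choose_symm_add]
        exact_mod_cast Nat.add_choose_mul_factorial_mul_factorial ij.1 ij.2
      have hc' : ((ij.1 + ij.2).factorial : ℝ)⁻¹ * ((ij.1 + ij.2).choose ij.1 : ℝ)
          = (ij.1.factorial : ℝ)⁻¹ * (ij.2.factorial : ℝ)⁻¹ := by
        rw [← hc]
        have h1 : (ij.1.factorial : ℝ) ≠ 0 := by positivity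
        have h2 : (ij.2.factorial : ℝ) ≠ 0 := by positivity
        have h3 : ((ij.1 + ij.2).choose ij.1 : ℝ) ≠ 0 := by
          exact_mod_cast (Nat.choose_pos (Nat.le_add_right _ _)).ne'
        field_simp
      rw [map_nsmul, map_mul, ← Nat.cast_smul_eq_nsmul ℝ, smul_smul, hc', pow_add]
      simp only [Algebra.smul_def, map_mul]
      ring
    · intro p q hpq
      have : s ^ p * s ^ q = 0 := by
        rw [← pow_add]
        exact pow_eq_zero_of_le hpq hs
      rw [mul_mul_mul_comm, this, mul_zero]
  · change ∑ m ∈ Finset.range (l + 1), ((m.factorial : ℝ)⁻¹ • φ (D^[m] f)) * s ^ m = _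
    rw [Finset.sum_range]

theorem multi {A S : Type*} [CommRing A] [Algebra ℝ A] [CommRing S] [Algebra ℝ S]
    (l : ℕ) (j : ℕ) : ∀ (D : Fin j → Derivation ℝ A A) (s : Fin j → S)
    (_ : ∀ i, s i ^ (l + 1) = 0) (φ : A →ₐ[ℝ] S),
    ∃ ψ : A →ₐ[ℝ] S, ∀ f, ψ f = ∑ d : Fin j → Fin (l + 1),
      ((((∏ i, ((d i : ℕ)).factorial) : ℕ) : ℝ)⁻¹ •
        φ ((List.finRange j).foldr (fun i acc => (D i)^[(d i : ℕ)] acc) f)) *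
          ∏ i, s i ^ (d i : ℕ) := by
  induction j with
  | zero =>
    intro D s hs φ
    exact ⟨φ, fun f => by simp⟩
  | succ j ih =>
    intro D s hs φ
    obtain ⟨φ', hφ'⟩ := step (D 0) l (s 0) (hs 0) φ
    obtain ⟨ψ, hψ⟩ := ih (fun i => D i.succ) (fun i => s i.succ) (fun i => hs _) φ'
    refine ⟨ψ, fun f => ?_⟩
    rw [hψ, ← (Fin.consEquiv (fun _ => Fin (l + 1))).sum_comp, Fintype.sum_prod_type_right]
    refine Finset.sum_congr rfl fun d _ => ?_
    rw [hφ', Finset.smul_sum, Finset.sum_mul]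
    refine Finset.sum_congr rfl fun m _ => ?_
    simp only [Fin.consEquiv_apply, Fin.prod_univ_succ, Fin.cons_zero, Fin.cons_succ,
      List.finRange_succ, List.foldr_cons, List.foldr_map, Nat.cast_mul, mul_inv]
    simp only [Algebra.smul_def, map_mul]
    ring

/-- The algebra of smooth functions. -/
def smoothAlg (k : ℕ) : Subalgebra ℝ ((Fin k → ℝ) → ℝ) where
  carrier := {h | ContDiff ℝ (⊤ : ℕ∞) h}
  mul_mem' := by
    intro f g hf hg
    exact ContDiff.mul (𝕜 := ℝ) (n := (⊤ : ℕ∞)) (f := f) (g := g) hf hg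
  add_mem' := by
    intro f g hf hg
    exact ContDiff.add (𝕜 := ℝ) (n := (⊤ : ℕ∞)) (f := f) (g := g) hf hg
  algebraMap_mem' := by
    intro c
    exact contDiff_const (𝕜 := ℝ) (n := (⊤ : ℕ∞)) (c := c)

theorem smooth_pderiv {k : ℕ} (i : Fin k) {h : (Fin k → ℝ) → ℝ}
    (hh : ContDiff ℝ (⊤ : ℕ∞) h) : ContDiff ℝ (⊤ : ℕ∞) (pderiv1 i h) := by
  unfold pderiv1
  exact (hh.fderiv_right (by simp)).clm_apply contDiff_const

theorem smooth_diff {k : ℕ} {h : (Fin k → ℝ) → ℝ}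
    (hh : ContDiff ℝ (⊤ : ℕ∞) h) (x : Fin k → ℝ) : DifferentiableAt ℝ h x :=
  (hh.differentiable (by simp)) x

/-- Partial derivative as a derivation of the smooth algebra. -/
def pD {k : ℕ} (i : Fin k) : Derivation ℝ (smoothAlg k) (smoothAlg k) :=
  Derivation.mk'
    { toFun := fun f => ⟨pderiv1 i f.1, smooth_pderiv i f.2⟩
      map_add' := by
        intro f g
        ext x
        simp [pderiv1, fderiv_add (smooth_diff f.2 x) (smooth_diff g.2 x)]
      map_smul' := by
        intro c f
        ext x
        simp [pderiv1, fderiv_const_smul (smooth_diff f.2 x) c] }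
    (by
      intro f g
      ext x
      simp [pderiv1, fderiv_mul (smooth_diff f.2 x) (smooth_diff g.2 x)])

theorem pD_iter {k : ℕ} (i : Fin k) (m : ℕ) (f : smoothAlg k) :
    (((pD i)^[m] f : smoothAlg k) : (Fin k → ℝ) → ℝ) = pderivIter i m f.1 := by
  induction m with
  | zero => rfl
  | succ m ih =>
    rw [Function.iterate_succ_apply']
    change pderiv1 i (((pD i)^[m] f : smoothAlg k) : (Fin k → ℝ) → ℝ) = _
    rw [ih]
    rfl

theorem pD_foldr {k : ℕ} (d : Fin k → ℕ) (f : smoothAlg k) (L : List (Fin k)) :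
    ((L.foldr (fun i acc => (pD i)^[d i] acc) f : smoothAlg k) : (Fin k → ℝ) → ℝ) =
      L.foldr (fun i acc => pderivIter i (d i) acc) f.1 := by
  induction L with
  | nil => rfl
  | cons i L ih => rw [List.foldr_cons, List.foldr_cons, pD_iter, ih]

theorem exists_hom (S : Type*) [CommRing S] [Algebra ℝ S] (k l : ℕ) (a : Fin k → ℝ)
    (n : Fin k → S) (hn : ∀ i, n i ^ (l + 1) = 0) :
    ∃ ψ : smoothAlg k →ₐ[ℝ] S, ∀ f, nilTaylor S k l a n f.1 = ψ f := by
  obtain ⟨ψ, hψ⟩ := multi (A := smoothAlg k) l k pD n hn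
    ((Algebra.ofId ℝ S).comp
      ((Pi.evalAlgHom ℝ (fun _ : Fin k → ℝ => ℝ) a).comp (smoothAlg k).val))
  refine ⟨ψ, fun f => ?_⟩
  rw [hψ, nilTaylor]
  refine Finset.sum_congr rfl fun d _ => ?_
  simp only [AlgHom.comp_apply, Subalgebra.coe_val, Pi.evalAlgHom_apply, Algebra.ofId_apply,
    pD_foldr (fun i => (d i : ℕ)), multiPDeriv, Algebra.smul_def, map_mul]

/-- If `n_i^{l+1} = 0` for every `i`, then the nilpotent Taylor
evaluation `T` is an `ℝ`-algebra homomorphism from `C^∞(ℝ^k;ℝ)` to `S`: it is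
`ℝ`-linear, `T(1) = 1`, and `T(h₁·h₂) = T(h₁)·T(h₂)` for all smooth `h₁, h₂`. -/
theorem stmt0 (S : Type*) [CommRing S] [Algebra ℝ S] (k l : ℕ) (a : Fin k → ℝ)
    (n : Fin k → S) (hn : ∀ i, n i ^ (l + 1) = 0) :
    (∀ h₁ h₂ : (Fin k → ℝ) → ℝ, ContDiff ℝ (⊤ : ℕ∞) h₁ → ContDiff ℝ (⊤ : ℕ∞) h₂ →
      nilTaylor S k l a n (h₁ + h₂) = nilTaylor S k l a n h₁ + nilTaylor S k l a n h₂) ∧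
    (∀ (c : ℝ) (h : (Fin k → ℝ) → ℝ), ContDiff ℝ (⊤ : ℕ∞) h →
      nilTaylor S k l a n (c • h) = c • nilTaylor S k l a n h) ∧
    nilTaylor S k l a n 1 = 1 ∧
    (∀ h₁ h₂ : (Fin k → ℝ) → ℝ, ContDiff ℝ (⊤ : ℕ∞) h₁ → ContDiff ℝ (⊤ : ℕ∞) h₂ →
      nilTaylor S k l a n (h₁ * h₂) =
        nilTaylor S k l a n h₁ * nilTaylor S k l a n h₂) := by
  obtain ⟨ψ, hψ⟩ := exists_hom S k l a n hn
  refine ⟨fun h₁ h₂ s₁ s₂ => ?_, fun c h s => ?_, ?_, fun h₁ h₂ s₁ s₂ => ?_⟩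
  · have := map_add ψ ⟨h₁, s₁⟩ ⟨h₂, s₂⟩
    rwa [← hψ, ← hψ, ← hψ] at this
  · have := map_smul ψ c ⟨h, s⟩
    rwa [← hψ, ← hψ] at this
  · have := map_one ψ
    rwa [← hψ] at this
  · have := map_mul ψ ⟨h₁, s₁⟩ ⟨h₂, s₂⟩
    rwa [← hψ, ← hψ, ← hψ] at this

end NilTaylor

end
end

section
/- Let S be a commutative ℝ-algebra, let k, l ∈ ℕ, let a ∈ ℝ^k, let n₁, …, n_k ∈ S satisfy n_i^{l+1} = 0 for every i, and for smooth h : ℝ^k → ℝ let T(h) := Σ_{d = (d₁,…,d_k), 0 ≤ d_i ≤ l} (d₁!⋯d_k!)⁻¹ · ((∂₁^{d₁}⋯∂_k^{d_k} h)(a)) · n₁^{d₁}⋯n_k^{d_k} ∈ S. Then for every m ∈ ℕ, every smooth g : ℝ^m → ℝ, and all smooth h₁, …, h_m : ℝ^k → ℝ: each element T(h_j) − h_j(a)·1 is nilpotent with (T(h_j) − h_j(a)·1)^{k·l+1} = 0, and T(g ∘ (h₁,…,h_m)) = Σ_{e = (e₁,…,e_m), 0 ≤ e_j ≤ k·l}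 (e₁!⋯e_m!)⁻¹ · ((∂₁^{e₁}⋯∂_m^{e_m} g)(h₁(a),…,h_m(a))) · ∏_{j=1}^m (T(h_j) − h_j(a)·1)^{e_j}; that is, the nilpotent Taylor evaluation is compatible with composition of smooth functions. -/
noncomputable section

namespace NilTaylor

/-- The algebra of smooth functions. -/
def Sm (k : ℕ) : Subalgebra ℝ ((Fin k → ℝ) → ℝ) where
  carrier := {f | ContDiff ℝ (⊤ : ℕ∞) f}
  mul_mem' := fun {f g} (hf : ContDiff ℝ (⊤ : ℕ∞) f) (hg : ContDiff ℝ (⊤ : ℕ∞) g) =>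
    show ContDiff ℝ (⊤ : ℕ∞) (fun x => f x * g x) from hf.mul hg
  add_mem' := fun {f g} (hf : ContDiff ℝ (⊤ : ℕ∞) f) (hg : ContDiff ℝ (⊤ : ℕ∞) g) =>
    show ContDiff ℝ (⊤ : ℕ∞) (fun x => f x + g x) from hf.add hg
  algebraMap_mem' := fun c =>
    show ContDiff ℝ (⊤ : ℕ∞) (fun _ : Fin k → ℝ => c) from contDiff_const

lemma sm {k : ℕ} (f : Sm k) : ContDiff ℝ (⊤ : ℕ∞) (f : (Fin k → ℝ) → ℝ) := f.2

lemma df {k : ℕ} (f : Sm k) : Differentiable ℝ (f : (Fin k → ℝ) → ℝ) :=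
  (sm f).differentiable (by simp)

lemma smooth_pderiv1 {k : ℕ} (i : Fin k) {f : (Fin k → ℝ) → ℝ} (hf : ContDiff ℝ (⊤ : ℕ∞) f) :
    ContDiff ℝ (⊤ : ℕ∞) (pderiv1 i f) := by
  have h1 : ContDiff ℝ (⊤ : ℕ∞) (fderiv ℝ f) := hf.fderiv_right (by simp)
  exact h1.clm_apply contDiff_const

/-- Partial derivative as a map on smooth functions. -/
def D {k : ℕ} (i : Fin k) (f : Sm k) : Sm k := ⟨pderiv1 i f, smooth_pderiv1 i f.2⟩

lemma D_apply {k : ℕ} (i : Fin k) (f : Sm k) (x : Fin k → ℝ) :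
    (D i f : (Fin k → ℝ) → ℝ) x = fderiv ℝ (f : (Fin k → ℝ) → ℝ) x (Pi.single i 1) := rfl

lemma D_add {k : ℕ} (i : Fin k) (f g : Sm k) : D i (f + g) = D i f + D i g := by
  ext x
  simp only [D_apply, Subalgebra.coe_add, Pi.add_apply]
  rw [fderiv_add ((df f) x) ((df g) x)]; rfl

lemma D_smul {k : ℕ} (i : Fin k) (c : ℝ) (f : Sm k) : D i (c • f) = c • D i f := by
  ext x
  simp only [D_apply, Subalgebra.coe_smul, Pi.smul_apply]
  rw [fderiv_const_smul ((df f) x)]; rfl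

lemma D_mul {k : ℕ} (i : Fin k) (f g : Sm k) : D i (f * g) = D i f * g + f * D i g := by
  ext x
  simp only [D_apply, Subalgebra.coe_add, Subalgebra.coe_mul, Pi.add_apply, Pi.mul_apply]
  rw [fderiv_mul ((df f) x) ((df g) x)]
  simp
  ring

lemma D_comm {k : ℕ} (i j : Fin k) (f : Sm k) : D i (D j f) = D j (D i f) := by
  ext x
  have h1 : Differentiable ℝ (fderiv ℝ (f : (Fin k → ℝ) → ℝ)) :=
    ((sm f).fderiv_right (m := (⊤ : ℕ∞)) (by simp)).differentiable (by simp)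
  have key : ∀ i j : Fin k, (D i (D j f) : (Fin k → ℝ) → ℝ) x =
      fderiv ℝ (fderiv ℝ (f : (Fin k → ℝ) → ℝ)) x (Pi.single i 1) (Pi.single j 1) := by
    intro i j
    rw [D_apply]
    have : ((D j f : Sm k) : (Fin k → ℝ) → ℝ) =
        fun y => fderiv ℝ (f : (Fin k → ℝ) → ℝ) y (Pi.single j 1) := rfl
    rw [this, fderiv_clm_apply (h1 x) (differentiableAt_const _)]
    simp
  rw [key, key]
  exact ((sm f).contDiffAt.isSymmSndFDerivAt (by
    rw [minSmoothness_of_isRCLikeNormedField]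
    exact WithTop.coe_le_coe.mpr (le_top : (2 : ℕ∞) ≤ ⊤))) _ _

/-- Multi-index derivative along a list. -/
def ML {k : ℕ} (d : Fin k → ℕ) (L : List (Fin k)) (f : Sm k) : Sm k :=
  L.foldr (fun i acc => (D i)^[d i] acc) f

lemma ML_cons {k : ℕ} (d : Fin k → ℕ) (j : Fin k) (L : List (Fin k)) (f : Sm k) :
    ML d (j :: L) f = (D j)^[d j] (ML d L f) := rfl

lemma pderivIter_coe {k : ℕ} (i : Fin k) (n : ℕ) (f : Sm k) :
    pderivIter i n f = ((D i)^[n] f : Sm k) := by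
  induction n with
  | zero => rfl
  | succ n ih => rw [Function.iterate_succ_apply']; show pderiv1 i (pderivIter i n f) = _; rw [ih]; rfl

lemma multiPDeriv_coe {k : ℕ} (d : Fin k → ℕ) (f : Sm k) :
    multiPDeriv d f = (ML d (List.finRange k) f : Sm k) := by
  unfold multiPDeriv ML
  induction List.finRange k with
  | nil => rfl
  | cons j L ih => rw [List.foldr_cons, List.foldr_cons, ih, pderivIter_coe]

lemma D_comm_iter {k : ℕ} (i j : Fin k) (n : ℕ) (f : Sm k) :
    D i ((D j)^[n] f) = (D j)^[n] (D i f) :=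
  ((show Function.Commute (D i) (D j) from fun f => D_comm i j f).iterate_right n) f

lemma ML_D {k : ℕ} (d : Fin k → ℕ) (i : Fin k) (L : List (Fin k)) (f : Sm k) :
    ML d L (D i f) = D i (ML d L f) := by
  induction L with
  | nil => rfl
  | cons j L ih => rw [ML_cons, ML_cons, ih, D_comm_iter]

lemma ML_succ {k : ℕ} (d : Fin k → ℕ) (i : Fin k) (L : List (Fin k)) (hL : L.Nodup) (f : Sm k) :
    ML (d + Pi.single i 1) L f = if i ∈ L then D i (ML d L f) else ML d L f := by
  induction L with
  | nil => rfl
  | cons j L ih =>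
    rw [List.nodup_cons] at hL
    rw [ML_cons, ML_cons, ih hL.2]
    by_cases hij : i = j
    · subst hij
      simp [hL.1, Function.iterate_succ_apply']
    · have : j ≠ i := fun h => hij h.symm
      by_cases hi : i ∈ L <;> simp [hi, hij, this, D_comm_iter]

/-- Multi-index derivative. -/
def MD {k : ℕ} (d : Fin k →₀ ℕ) (f : Sm k) : Sm k := ML d (List.finRange k) f

lemma MD_succ {k : ℕ} (d : Fin k →₀ ℕ) (i : Fin k) (f : Sm k) :
    MD (d + Finsupp.single i 1) f = MD d (D i f) := by
  have := ML_succ d i (List.finRange k) (List.nodup_finRange k) f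
  unfold MD
  rw [ML_D, Finsupp.coe_add, Finsupp.single_eq_pi_single, this]
  simp

lemma MD_zero {k : ℕ} (f : Sm k) : MD 0 f = f := by
  unfold MD
  induction List.finRange k with
  | nil => rfl
  | cons j L ih => rw [ML_cons, ih]; rfl

/-- Induction principle for multi-indices. -/
lemma idx_induction {k : ℕ} {p : (Fin k →₀ ℕ) → Prop} (h0 : p 0)
    (hs : ∀ d i, p d → p (d + Finsupp.single i 1)) (d : Fin k →₀ ℕ) : p d := by
  induction hN : d.degree generalizing d with
  | zero => rw [Finsupp.degree_eq_zero_iff] at hN; rwa [hN]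
  | succ N ih =>
    have hd : d ≠ 0 := by rintro rfl; simp at hN
    obtain ⟨i, hi⟩ := Finsupp.ne_iff.mp hd
    have h1 : d - Finsupp.single i 1 + Finsupp.single i 1 = d := by
      apply tsub_add_cancel_of_le
      simpa [Nat.one_le_iff_ne_zero] using hi
    rw [← h1]
    apply hs
    apply ih
    rw [← h1] at hN
    simpa using hN

lemma MD_add {k : ℕ} (d : Fin k →₀ ℕ) (f g : Sm k) : MD d (f + g) = MD d f + MD d g := by
  induction d using idx_induction generalizing f g with
  | h0 => simp [MD_zero]
  | hs d i ih => simp [MD_succ, D_add, ih]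

lemma MD_smul {k : ℕ} (d : Fin k →₀ ℕ) (c : ℝ) (f : Sm k) : MD d (c • f) = c • MD d f := by
  induction d using idx_induction generalizing f with
  | h0 => simp [MD_zero]
  | hs d i ih => simp [MD_succ, D_smul, ih]

/-- Formal Taylor series. -/
def tay {k : ℕ} (a : Fin k → ℝ) (f : Sm k) : MvPowerSeries (Fin k) ℝ :=
  fun d => (((∏ i, (d i).factorial : ℕ) : ℝ))⁻¹ * (MD d f : (Fin k → ℝ) → ℝ) a

lemma coeff_tay {k : ℕ} (a : Fin k → ℝ) (f : Sm k) (d : Fin k →₀ ℕ) :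
    MvPowerSeries.coeff d (tay a f) =
      (((∏ i, (d i).factorial : ℕ) : ℝ))⁻¹ * (MD d f : (Fin k → ℝ) → ℝ) a := rfl

lemma coeff_tay_zero {k : ℕ} (a : Fin k → ℝ) (f : Sm k) :
    MvPowerSeries.coeff 0 (tay a f) = (f : (Fin k → ℝ) → ℝ) a := by
  simp [coeff_tay, MD_zero]

lemma tay_add {k : ℕ} (a : Fin k → ℝ) (f g : Sm k) : tay a (f + g) = tay a f + tay a g := by
  ext d
  simp [coeff_tay, MD_add, mul_add]

lemma tay_smul {k : ℕ} (a : Fin k → ℝ) (c : ℝ) (f : Sm k) : tay a (c • f) = c • tay a f := by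
  ext d
  simp [coeff_tay, MD_smul]
  ring

lemma pderiv_tay {k : ℕ} (a : Fin k → ℝ) (i : Fin k) (f : Sm k) :
    MvPowerSeries.pderiv ℝ i (tay a f) = tay a (D i f) := by
  ext d
  rw [MvPowerSeries.coeff_pderiv, coeff_tay, coeff_tay, MD_succ]
  have h1 : (∏ j, ((d + Finsupp.single i 1 : Fin k →₀ ℕ) j).factorial) = (d i + 1) * ∏ j, (d j).factorial := by
    rw [← Finset.mul_prod_erase _ _ (Finset.mem_univ i),
      ← Finset.mul_prod_erase Finset.univ (fun j => (d j).factorial) (Finset.mem_univ i)]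
    simp only [Finsupp.add_apply, Finsupp.single_eq_same, Nat.factorial_succ]
    rw [mul_assoc]
    congr 2
    apply Finset.prod_congr rfl
    intro j hj
    have : j ≠ i := (Finset.mem_erase.mp hj).1
    simp [this]
  rw [h1]
  have h2 : ((∏ j, (d j).factorial : ℕ) : ℝ) ≠ 0 := by
    exact_mod_cast Finset.prod_ne_zero_iff.mpr fun j _ => Nat.factorial_ne_zero _
  have h3 : (d i : ℝ) + 1 ≠ 0 := by positivity
  push_cast at h2 ⊢
  field_simp

/-- Coefficient recursion. -/
lemma coeff_succ {k : ℕ} (F : MvPowerSeries (Fin k) ℝ) (d : Fin k →₀ ℕ) (i : Fin k) :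
    MvPowerSeries.coeff (d + Finsupp.single i 1) F =
      MvPowerSeries.coeff d (MvPowerSeries.pderiv ℝ i F) / ((d i : ℝ) + 1) := by
  have h3 : (d i : ℝ) + 1 ≠ 0 := by positivity
  rw [MvPowerSeries.coeff_pderiv]
  field_simp

lemma tay_mul {k : ℕ} (a : Fin k → ℝ) (f g : Sm k) : tay a (f * g) = tay a f * tay a g := by
  ext d
  induction d using idx_induction generalizing f g with
  | h0 =>
    rw [coeff_tay_zero]
    simp only [MvPowerSeries.coeff_zero_eq_constantCoeff, map_mul]
    simp only [← MvPowerSeries.coeff_zero_eq_constantCoeff_apply, coeff_tay_zero]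
    rfl
  | hs d i ih =>
    rw [coeff_succ, coeff_succ, pderiv_tay, D_mul, tay_add, map_add, ih, ih, Derivation.leibniz,
      pderiv_tay, pderiv_tay, map_add]
    simp only [smul_eq_mul]
    rw [mul_comm (tay a g), add_comm]

lemma tay_one {k : ℕ} (a : Fin k → ℝ) : tay a (1 : Sm k) = 1 := by
  have h0 : ∀ i : Fin k, D i (1 : Sm k) = (0 : ℝ) • 1 := by
    intro i
    ext x
    rw [D_apply]
    have : ((1 : Sm k) : (Fin k → ℝ) → ℝ) = fun _ => 1 := rfl
    rw [this]
    simp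
  ext d
  induction d using idx_induction with
  | h0 => rw [coeff_tay_zero]; simp
  | hs d i ih =>
    rw [coeff_succ, coeff_succ, pderiv_tay, h0, tay_smul]
    simp

/-- The formal Taylor expansion as an algebra homomorphism. -/
def tayHom {k : ℕ} (a : Fin k → ℝ) : Sm k →ₐ[ℝ] MvPowerSeries (Fin k) ℝ :=
  AlgHom.ofLinearMap
    { toFun := tay a, map_add' := tay_add a, map_smul' := tay_smul a } (tay_one a) (tay_mul a)

lemma tayHom_apply {k : ℕ} (a : Fin k → ℝ) (f : Sm k) : tayHom a f = tay a f := rfl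

/-- Shifted coordinate function. -/
def crd {k : ℕ} (a : Fin k → ℝ) (j : Fin k) : Sm k :=
  ⟨fun x => x j - a j, show ContDiff ℝ (⊤ : ℕ∞) (fun x : Fin k → ℝ => x j - a j) from
    (contDiff_apply ℝ ℝ j).sub contDiff_const⟩

lemma tay_crd {k : ℕ} (a : Fin k → ℝ) (j : Fin k) : tay a (crd a j) = MvPowerSeries.X j := by
  classical
  have h0 : ∀ i : Fin k, D i (crd a j) = (if i = j then (1 : ℝ) else 0) • (1 : Sm k) := by
    intro i
    ext x
    rw [D_apply]
    have : ((crd a j : Sm k) : (Fin k → ℝ) → ℝ) = fun x => x j - a j := rfl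
    rw [this, fderiv_sub_const]
    have : fderiv ℝ (fun x : Fin k → ℝ => x j) x = ContinuousLinearMap.proj j :=
      (ContinuousLinearMap.proj (R := ℝ) (φ := fun _ : Fin k => ℝ) j).fderiv
    rw [this]
    by_cases hij : i = j
    · subst hij; simp
    · have : j ≠ i := fun h => hij h.symm
      simp [hij, this]
  ext d
  induction d using idx_induction with
  | h0 => rw [coeff_tay_zero]; simp [crd]
  | hs d i ih =>
    rw [coeff_succ, coeff_succ, pderiv_tay, h0, tay_smul, tay_one]
    rw [MvPowerSeries.pderiv_X]
    by_cases hij : i = j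
    · subst hij; simp
    · simp [hij]

/-- Vanishing up to order `N`. -/
def Van {k : ℕ} (a : Fin k → ℝ) (N : ℕ) (f : Sm k) : Prop :=
  ∀ d : Fin k →₀ ℕ, d.degree ≤ N → MvPowerSeries.coeff d (tay a f) = 0

lemma Van.mono {k : ℕ} {a : Fin k → ℝ} {N : ℕ} {f : Sm k} (h : Van a (N + 1) f) : Van a N f :=
  fun d hd => h d (by omega)

lemma Van.add {k : ℕ} {a : Fin k → ℝ} {N : ℕ} {f g : Sm k} (hf : Van a N f) (hg : Van a N g) :
    Van a N (f + g) := fun d hd => by rw [tay_add, map_add, hf d hd, hg d hd, add_zero]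

lemma Van.sum {k : ℕ} {a : Fin k → ℝ} {N : ℕ} {ι : Type*} (s : Finset ι) {f : ι → Sm k}
    (hf : ∀ i ∈ s, Van a N (f i)) : Van a N (∑ i ∈ s, f i) := fun d hd => by
  rw [← tayHom_apply, map_sum, map_sum]
  exact Finset.sum_eq_zero fun i hi => hf i hi d hd

lemma Van.D {k : ℕ} {a : Fin k → ℝ} {N : ℕ} {f : Sm k} (h : Van a (N + 1) f) (i : Fin k) :
    Van a N (D i f) := fun d hd => by
  rw [← pderiv_tay, MvPowerSeries.coeff_pderiv, h _ (by simpa using hd), zero_mul]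

lemma Van.of_D {k : ℕ} {a : Fin k → ℝ} {N : ℕ} {f : Sm k} (h0 : (f : (Fin k → ℝ) → ℝ) a = 0)
    (h : ∀ i, Van a N (NilTaylor.D i f)) : Van a (N + 1) f := fun d => by
  cases d using idx_induction with
  | h0 => intro _; rw [coeff_tay_zero, h0]
  | hs d i _ =>
    intro hd
    rw [coeff_succ, pderiv_tay, h i d (by simpa using hd), zero_div]

/-- Composition. -/
def cmp {k m : ℕ} (g : Sm m) (h : Fin m → Sm k) : Sm k :=
  ⟨fun x => (g : (Fin m → ℝ) → ℝ) fun j => (h j : (Fin k → ℝ) → ℝ) x,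
    (sm g).comp (contDiff_pi.mpr fun j => sm (h j))⟩

lemma cmp_apply {k m : ℕ} (g : Sm m) (h : Fin m → Sm k) (x : Fin k → ℝ) :
    (cmp g h : (Fin k → ℝ) → ℝ) x =
      (g : (Fin m → ℝ) → ℝ) fun j => (h j : (Fin k → ℝ) → ℝ) x := rfl

lemma D_cmp {k m : ℕ} (g : Sm m) (h : Fin m → Sm k) (i : Fin k) :
    D i (cmp g h) = ∑ j, D i (h j) * cmp (D j g) h := by
  ext x
  have hH : HasFDerivAt (fun x => fun j => (h j : (Fin k → ℝ) → ℝ) x)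
      (ContinuousLinearMap.pi fun j => fderiv ℝ (h j : (Fin k → ℝ) → ℝ) x) x :=
    hasFDerivAt_pi.mpr fun j => (df (h j) x).hasFDerivAt
  have hG := ((df g) (fun j => (h j : (Fin k → ℝ) → ℝ) x)).hasFDerivAt
  have hc := (hG.comp x hH).fderiv
  rw [D_apply]
  have e : ((cmp g h : Sm k) : (Fin k → ℝ) → ℝ) =
    (g : (Fin m → ℝ) → ℝ) ∘ (fun x => fun j => (h j : (Fin k → ℝ) → ℝ) x) := rfl
  rw [e, hc]
  simp only [ContinuousLinearMap.comp_apply]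
  refine (LinearMap.pi_apply_eq_sum_univ (fderiv ℝ (g : (Fin m → ℝ) → ℝ) _).toLinearMap _).trans ?_
  rw [AddSubmonoidClass.coe_finsetSum, Finset.sum_apply]
  apply Finset.sum_congr rfl
  intro j _
  simp only [Subalgebra.coe_mul, Pi.mul_apply, cmp_apply, D_apply, smul_eq_mul]
  congr 1
  refine congrArg (fderiv ℝ (g : (Fin m → ℝ) → ℝ) _) ?_
  ext j'
  simp [Pi.single_apply, eq_comm]

lemma Van.cmp {k m : ℕ} (h : Fin m → Sm k) (a : Fin k → ℝ) (N : ℕ) (u : Sm k) (r : Sm m)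
    (hr : Van (fun j => (h j : (Fin k → ℝ) → ℝ) a) N r) : Van a N (u * cmp r h) := by
  have hz : ((u * NilTaylor.cmp r h : Sm k) : (Fin k → ℝ) → ℝ) a = 0 := by
    have := hr 0 (by simp)
    rw [coeff_tay_zero] at this
    simp [cmp_apply, this]
  induction N generalizing u r with
  | zero =>
    intro d hd
    have : d = 0 := by rw [← Finsupp.degree_eq_zero_iff]; omega
    rw [this, coeff_tay_zero, hz]
  | succ N ih =>
    have hz' : ∀ (u : Sm k) (r : Sm m), Van (fun j => (h j : (Fin k → ℝ) → ℝ) a) N r →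
        ((u * NilTaylor.cmp r h : Sm k) : (Fin k → ℝ) → ℝ) a = 0 := by
      intro u r hr
      have := hr 0 (by simp)
      rw [coeff_tay_zero] at this
      simp [cmp_apply, this]
    refine Van.of_D hz fun i => ?_
    rw [D_mul, D_cmp, Finset.mul_sum]
    refine Van.add (ih _ _ hr.mono (hz' _ _ hr.mono)) (Van.sum _ fun j _ => ?_)
    rw [← mul_assoc]
    exact ih _ _ (hr.D j) (hz' _ _ (hr.D j))

section ev

variable {S : Type*} [CommRing S] [Algebra ℝ S] {k : ℕ} (l : ℕ) (n : Fin k → S)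

/-- The bounding multi-index. -/
def bd (k l : ℕ) : Fin k →₀ ℕ := Finsupp.equivFunOnFinite.symm fun _ => l

lemma le_bd {d : Fin k →₀ ℕ} : d ≤ bd k l ↔ ∀ i, d i ≤ l := Iff.rfl

lemma aeval_zero (hn : ∀ i, n i ^ (l + 1) = 0) (p : MvPolynomial (Fin k) ℝ)
    (hp : ∀ d ≤ bd k l, p.coeff d = 0) : MvPolynomial.aeval n p = 0 := by
  rw [MvPolynomial.aeval_def, MvPolynomial.eval₂_eq']
  apply Finset.sum_eq_zero
  intro d _
  by_cases hd : d ≤ bd k l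
  · rw [hp d hd]; simp
  · rw [le_bd] at hd
    push Not at hd
    obtain ⟨i, hi⟩ := hd
    rw [Finset.prod_eq_zero (Finset.mem_univ i) (show n i ^ d i = 0 from pow_eq_zero_of_le hi (hn i)), mul_zero]

/-- Evaluation of power series at nilpotents. -/
def ev (hn : ∀ i, n i ^ (l + 1) = 0) : MvPowerSeries (Fin k) ℝ →ₐ[ℝ] S :=
  AlgHom.ofLinearMap
    ((MvPolynomial.aeval n).toLinearMap ∘ₗ MvPowerSeries.trunc' ℝ (bd k l))
    (by simp)
    (by
      intro F G
      simp only [LinearMap.comp_apply, AlgHom.toLinearMap_apply]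
      rw [← map_mul, ← sub_eq_zero, ← map_sub]
      apply aeval_zero l n hn
      intro d hd
      rw [MvPolynomial.coeff_sub, MvPowerSeries.coeff_trunc'_mul_trunc'_eq_coeff_mul _ _ _ hd,
        MvPowerSeries.coeff_trunc', if_pos hd, sub_self])

lemma ev_apply (hn : ∀ i, n i ^ (l + 1) = 0) (F : MvPowerSeries (Fin k) ℝ) :
    ev l n hn F = MvPolynomial.aeval n (MvPowerSeries.trunc' ℝ (bd k l) F) := rfl

lemma ev_zero (hn : ∀ i, n i ^ (l + 1) = 0) (F : MvPowerSeries (Fin k) ℝ)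
    (hF : ∀ d : Fin k →₀ ℕ, d.degree ≤ k * l → MvPowerSeries.coeff d F = 0) :
    ev l n hn F = 0 := by
  rw [ev_apply]
  apply aeval_zero l n hn
  intro d hd
  rw [MvPowerSeries.coeff_trunc', if_pos hd]
  apply hF
  rw [Finsupp.degree_eq_sum]
  refine (Finset.sum_le_sum fun i _ => hd i).trans ?_
  simp [bd]

/-- Box multi-index as a finitely supported function. -/
def idx {k l : ℕ} (d : Fin k → Fin (l + 1)) : Fin k →₀ ℕ :=
  Finsupp.equivFunOnFinite.symm fun i => (d i : ℕ)

lemma idx_apply {k l : ℕ} (d : Fin k → Fin (l + 1)) (i : Fin k) : idx d i = (d i : ℕ) := rfl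

lemma idx_inj {k l : ℕ} : Function.Injective (idx (k := k) (l := l)) := by
  intro d e h
  ext i
  exact DFunLike.congr_fun h i

lemma idx_surj {k l : ℕ} (d : Fin k →₀ ℕ) (hd : ∀ i, d i ≤ l) :
    ∃ e : Fin k → Fin (l + 1), idx e = d :=
  ⟨fun i => ⟨d i, Nat.lt_succ_of_le (hd i)⟩, by ext i; rfl⟩

lemma nilTaylor_eq (hn : ∀ i, n i ^ (l + 1) = 0) (a : Fin k → ℝ) (f : Sm k) :
    nilTaylor S k l a n f = ev l n hn (tay a f) := by
  rw [ev_apply, MvPowerSeries.trunc', MvPowerSeries.truncFinset_apply, map_sum, nilTaylor]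
  refine Finset.sum_bij (fun d _ => idx d) ?_ ?_ ?_ ?_
  · intro d _
    rw [Finset.mem_Iic, le_bd]
    intro i
    rw [idx_apply]
    exact Nat.le_of_lt_succ (d i).2
  · intro d _ e _ h
    exact idx_inj h
  · intro d hd
    rw [Finset.mem_Iic, le_bd] at hd
    obtain ⟨e, he⟩ := idx_surj d hd
    exact ⟨e, Finset.mem_univ _, he⟩
  · intro d _
    rw [MvPolynomial.aeval_monomial, coeff_tay, Algebra.smul_def, multiPDeriv_coe,
      Finsupp.prod_fintype _ _ (by simp)]
    rfl

end ev

/-- Composition as an algebra homomorphism. -/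
def cmpHom {k m : ℕ} (h : Fin m → Sm k) : Sm m →ₐ[ℝ] Sm k where
  toFun g := cmp g h
  map_one' := rfl
  map_mul' _ _ := rfl
  map_zero' := rfl
  map_add' _ _ := rfl
  commutes' _ := rfl

/-- Box Taylor polynomial. -/
def tpoly {m : ℕ} (N : ℕ) (b : Fin m → ℝ) (g : Sm m) : Sm m :=
  ∑ e : Fin m → Fin (N + 1), MvPowerSeries.coeff (idx e) (tay b g) • ∏ j, crd b j ^ (e j : ℕ)

lemma monomial_prod {m : ℕ} (d : Fin m →₀ ℕ) :
    ∏ j, (MvPowerSeries.X j : MvPowerSeries (Fin m) ℝ) ^ d j = MvPowerSeries.monomial d 1 := by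
  have := MvPolynomial.monomial_eq (s := d) (a := (1 : ℝ))
  rw [Finsupp.prod_fintype _ _ (by simp)] at this
  rw [← MvPolynomial.coe_monomial, this]
  simp [← MvPolynomial.coe_X, ← MvPolynomial.coeToMvPowerSeries.ringHom_apply, map_prod]

lemma van_sub_tpoly {m : ℕ} (N : ℕ) (b : Fin m → ℝ) (g : Sm m) : Van b N (g - tpoly N b g) := by
  classical
  intro d hd
  obtain ⟨e, rfl⟩ := idx_surj (l := N) d fun i => (Finsupp.le_degree i d).trans hd
  rw [← tayHom_apply, map_sub, map_sub, tpoly, map_sum, map_sum, sub_eq_zero, tayHom_apply]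
  rw [Finset.sum_eq_single e]
  · simp only [map_smul, map_prod, map_pow, tayHom_apply, tay_crd]
    have := monomial_prod (idx e)
    simp only [idx_apply] at this
    rw [this]
    simp
  · intro e' _ hne
    simp only [map_smul, map_prod, map_pow, tayHom_apply, tay_crd]
    have := monomial_prod (idx e')
    simp only [idx_apply] at this
    rw [this, MvPowerSeries.coeff_monomial, if_neg fun h => hne (idx_inj h.symm), smul_zero]
  · simp

/-- If `n_i^{l+1} = 0` for every `i`, then for every smooth
`g : ℝ^m → ℝ` and smooth `h₁,…,h_m : ℝ^k → ℝ`:  each `T(h_j) − h_j(a)·1` is nilpotent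
with `(T(h_j) − h_j(a)·1)^{k·l+1} = 0`, and the nilpotent Taylor evaluation is
compatible with composition of smooth functions. -/
theorem stmt1 (S : Type*) [CommRing S] [Algebra ℝ S] (k l : ℕ) (a : Fin k → ℝ)
    (n : Fin k → S) (hn : ∀ i, n i ^ (l + 1) = 0) (m : ℕ)
    (g : (Fin m → ℝ) → ℝ) (hg : ContDiff ℝ (⊤ : ℕ∞) g)
    (h : Fin m → (Fin k → ℝ) → ℝ) (hh : ∀ j, ContDiff ℝ (⊤ : ℕ∞) (h j)) :
    (∀ j : Fin m,
      (nilTaylor S k l a n (h j) - algebraMap ℝ S (h j a)) ^ (k * l + 1) = 0) ∧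
    nilTaylor S k l a n (fun x => g fun j => h j x) =
      ∑ e : Fin m → Fin (k * l + 1),
        ((((∏ j, ((e j : ℕ)).factorial) : ℕ) : ℝ)⁻¹ *
            multiPDeriv (fun j => (e j : ℕ)) g (fun j => h j a)) •
          ∏ j, (nilTaylor S k l a n (h j) - algebraMap ℝ S (h j a)) ^ (e j : ℕ) := by
  let hS : Fin m → Sm k := fun j => ⟨h j, hh j⟩
  let gS : Sm m := ⟨g, hg⟩
  have e1 : ∀ j, nilTaylor S k l a n (h j) - algebraMap ℝ S (h j a) =
      ev l n hn (tayHom a (hS j - algebraMap ℝ (Sm k) (h j a))) := by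
    intro j
    rw [map_sub, map_sub, AlgHom.commutes, AlgHom.commutes, tayHom_apply, ← nilTaylor_eq]
  constructor
  · intro j
    rw [e1, ← map_pow]
    apply ev_zero
    intro d hd
    apply MvPowerSeries.coeff_eq_zero_of_constantCoeff_nilpotent (m := 1)
    · rw [pow_one, ← MvPowerSeries.coeff_zero_eq_constantCoeff_apply, tayHom_apply,
        coeff_tay_zero]
      exact sub_self (h j a)
    · omega
  · have e2 : nilTaylor S k l a n (fun x => g fun j => h j x) =
        ev l n hn (tayHom a (cmpHom hS gS)) := nilTaylor_eq l n hn a (cmpHom hS gS)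
    let b : Fin m → ℝ := fun j => h j a
    have e3 : ev l n hn (tayHom a (cmpHom hS (gS - tpoly (k * l) b gS))) = 0 := by
      apply ev_zero
      have := Van.cmp hS a (k * l) 1 _ (van_sub_tpoly (k * l) b gS)
      rw [one_mul] at this
      exact this
    rw [map_sub, map_sub, map_sub, sub_eq_zero] at e3
    rw [e2, e3, tpoly]
    simp only [map_sum, map_smul, map_prod, map_pow]
    apply Finset.sum_congr rfl
    intro e _
    congr 1
    · rw [coeff_tay, MD, ← multiPDeriv_coe (idx e)]
      rfl
    · apply Finset.prod_congr rfl
      intro j _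
      rw [e1]
      rfl

end NilTaylor

end
end
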